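/- arXiv:2103.07831 — 2 statements merged into one kernel-verified Lean document; each statement's English description precedes it below -/
import Mathlib

section
/- For every integer N ≥ 2 and every x ∈ ℂ: c₁·F(x, N−1, 1) + Σ_{i=2}^{N} i!·c_i·F(x, N−1, i) = Σ_{μ ∈ C(N−2)} α^{x−(N−1−Σ_{i≥2}(i−1)μ_i)}·(N−1−Σ_{i≥2}(i−1)μ_i)·C(x, N−1−Σ_{i≥2}(i−1)μ_i)·(−1)^{μ₁}·(N−2+Σ_{i≥2}μ_i)!·c₁^{−(N−1+Σ_{i≥2}μ_i)}·∏_{i≥2} c_i^{μ_i}/μ_i!, where terms on the right with N−1−Σ_{i≥2}(i−1)μ_i ≤ 0 vanish (by the convention C(z,k) = 0 for k < 0 and C(z,0)·0 = 0). -/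
open Finset Complex

noncomputable def fallFac (z : ℂ) (k : ℕ) : ℂ := ∏ j ∈ Finset.range k, (z - j)

noncomputable def gbinom (z : ℂ) (k : ℤ) : ℂ :=
  if 0 ≤ k then fallFac z k.toNat / (Nat.factorial k.toNat) else 0

/-- Compositions of `r`: finitely supported sequences (μ₁, μ₂, …) of non-negative
integers summing to `r`, represented as tuples `μ : Fin (r+2) → ℕ` with `μ 0 = 0`
(so `μ i` is μ_i for `1 ≤ i ≤ r+1`; entries with index `> r+1` are necessarily 0
in any term that does not vanish). -/
def comps (r : ℕ) : Finset (Fin (r + 2) → ℕ) :=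
  (Fintype.piFinset fun _ => Finset.range (r + 1)).filter
    fun μ => μ 0 = 0 ∧ ∑ i, μ i = r

/-- `FF α c x r a` is the quantity F(x, r, a) of the paper. -/
noncomputable def FF (α : ℂ) (c : ℕ → ℂ) (x : ℂ) (r a : ℕ) : ℂ :=
  -α ^ x / ((Nat.factorial (a - 1)) : ℂ) *
    ∑ μ ∈ comps r,
      (-1 : ℂ) ^ μ 1 *
      gbinom x ((r : ℤ) - (∑ i : Fin (r + 2), ((i.val : ℤ) - 1) * μ i) - ((a : ℤ) - 1)) *
      ((Nat.factorial (r + ∑ i ∈ Finset.univ \ ({0, 1} : Finset (Fin (r + 2))), μ i)) : ℂ) *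
      α ^ (-((r : ℤ) - (∑ i : Fin (r + 2), ((i.val : ℤ) - 1) * μ i) - ((a : ℤ) - 1))) *
      c 1 ^ (-((r : ℤ) + 1 + ∑ i ∈ Finset.univ \ ({0, 1} : Finset (Fin (r + 2))), ((μ i : ℤ)))) *
      ∏ i ∈ Finset.univ \ ({0, 1} : Finset (Fin (r + 2))), (c i ^ μ i / ((Nat.factorial (μ i)) : ℂ))

/-- The sequences `(μ₂, …, μ_{d+1})` with entries at most `K`, indexed from `0`. -/
def tailBox (d K : ℕ) : Finset (Fin d → ℕ) :=
  Fintype.piFinset fun _ => Finset.range (K + 1)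

/-- The weight `∑_{i ≥ 2} (i - 1) μ_i` of a tail. -/
def tailWeight {d : ℕ} (ν : Fin d → ℕ) : ℕ := ∑ j, (j.val + 1) * ν j

/-- The product `∏_{i ≥ 2} c_i ^ μ_i / μ_i!` of a tail. -/
noncomputable def tailProd (c : ℕ → ℂ) {d : ℕ} (ν : Fin d → ℕ) : ℂ :=
  ∏ j, c (j.val + 2) ^ ν j / ((Nat.factorial (ν j)) : ℂ)

/-- Extension of a tuple by zero. -/
def zeroExtend {m : ℕ} (μ : Fin m → ℕ) (i : ℕ) : ℕ := if h : i < m then μ ⟨i, h⟩ else 0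

/-- The entries of index at least two of a tuple, extended by zero or truncated to length `d`. -/
def tail (d : ℕ) {m : ℕ} (μ : Fin m → ℕ) : Fin d → ℕ := fun j => zeroExtend μ (j.val + 2)

theorem mem_tailBox {d K : ℕ} {ν : Fin d → ℕ} : ν ∈ tailBox d K ↔ ∀ j, ν j ≤ K := by
  simp [tailBox]

theorem mem_comps {r : ℕ} {μ : Fin (r + 2) → ℕ} :
    μ ∈ comps r ↔ μ 0 = 0 ∧ ∑ i, μ i = r := by
  simp only [comps, Finset.mem_filter, Fintype.mem_piFinset, Finset.mem_range, and_iff_right_iff_imp]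
  rintro ⟨-, h⟩ i
  have := Finset.single_le_sum (f := μ) (fun _ _ => Nat.zero_le _) (Finset.mem_univ i)
  omega

theorem mul_apply_le_tailWeight {d : ℕ} (ν : Fin d → ℕ) (j : Fin d) :
    (j.val + 1) * ν j ≤ tailWeight ν :=
  Finset.single_le_sum (f := fun j : Fin d => (j.val + 1) * ν j)
    (fun _ _ => Nat.zero_le _) (Finset.mem_univ j)

theorem apply_le_tailWeight {d : ℕ} (ν : Fin d → ℕ) (j : Fin d) : ν j ≤ tailWeight ν :=
  (Nat.le_mul_of_pos_left _ (Nat.succ_pos _)).trans (mul_apply_le_tailWeight ν j)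

theorem sum_le_tailWeight {d : ℕ} (ν : Fin d → ℕ) : ∑ j, ν j ≤ tailWeight ν :=
  Finset.sum_le_sum fun _ _ => Nat.le_mul_of_pos_left _ (Nat.succ_pos _)

theorem gbinom_of_neg (z : ℂ) {k : ℤ} (hk : k < 0) : gbinom z k = 0 := by
  simp [gbinom, not_le.mpr hk]

@[to_additive]
theorem prod_univ_sdiff_pair {M : Type*} [CommMonoid M] {r : ℕ} (f : Fin (r + 2) → M) :
    ∏ i ∈ Finset.univ \ ({0, 1} : Finset (Fin (r + 2))), f i = ∏ j : Fin r, f j.succ.succ := by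
  symm
  refine Finset.prod_bij (fun j _ => j.succ.succ) ?_ ?_ ?_ ?_
  · intro j _
    simp [Fin.ext_iff]
  · intro a _ b _ h
    simpa using h
  · intro i hi
    simp only [Finset.mem_sdiff, Finset.mem_univ, true_and, Finset.mem_insert,
      Finset.mem_singleton, not_or, Fin.ext_iff, Fin.val_zero, Fin.val_one] at hi
    exact ⟨⟨i.val - 2, by omega⟩, Finset.mem_univ _, by ext; simp; omega⟩
  · intro _ _
    rfl

@[to_additive]
theorem prod_tail {M : Type*} [CommMonoid M] {r d : ℕ} (hrd : r ≤ d) (μ : Fin (r + 2) → ℕ)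
    (φ : ℕ → ℕ → M) (hφ : ∀ i, φ i 0 = 1) :
    ∏ j : Fin d, φ (j.val + 2) (tail d μ j) =
      ∏ i ∈ Finset.univ \ ({0, 1} : Finset (Fin (r + 2))), φ i.val (μ i) := by
  rw [prod_univ_sdiff_pair]
  have hr : ∀ j : Fin r, φ j.succ.succ.val (μ j.succ.succ) =
      φ (j.val + 2) (zeroExtend μ (j.val + 2)) := by
    intro j
    have hj : j.val + 2 < r + 2 := by omega
    simp only [zeroExtend, hj, dite_true]
    rfl
  rw [Finset.prod_congr rfl fun j _ => hr j]
  simp only [tail]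
  rw [Fin.prod_univ_eq_prod_range (fun k => φ (k + 2) (zeroExtend μ (k + 2))) d,
    Fin.prod_univ_eq_prod_range (fun k => φ (k + 2) (zeroExtend μ (k + 2))) r]
  symm
  refine Finset.prod_subset (Finset.range_mono hrd) fun k _ hk => ?_
  have hk' : ¬ k + 2 < r + 2 := by simpa using hk
  simp [zeroExtend, hk', hφ]


theorem sum_tail_eq {r d : ℕ} (hrd : r ≤ d) (μ : Fin (r + 2) → ℕ) :
    ∑ j, tail d μ j = ∑ i ∈ Finset.univ \ ({0, 1} : Finset (Fin (r + 2))), μ i :=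
  sum_tail hrd μ (fun _ k => k) fun _ => rfl

theorem tailProd_tail (c : ℕ → ℂ) {r d : ℕ} (hrd : r ≤ d) (μ : Fin (r + 2) → ℕ) :
    tailProd c (tail d μ) = ∏ i ∈ Finset.univ \ ({0, 1} : Finset (Fin (r + 2))),
      (c i ^ μ i / ((Nat.factorial (μ i)) : ℂ)) :=
  prod_tail hrd μ (fun i k => c i ^ k / ((Nat.factorial k) : ℂ)) fun _ => by simp

theorem tailWeight_tail {r d : ℕ} (hrd : r ≤ d) {μ : Fin (r + 2) → ℕ} (h0 : μ 0 = 0) :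
    (tailWeight (tail d μ) : ℤ) = ∑ i : Fin (r + 2), ((i.val : ℤ) - 1) * μ i := by
  have h := sum_tail hrd μ (fun i k => ((i : ℤ) - 1) * (k : ℤ)) fun _ => by simp
  rw [sum_univ_sdiff_pair] at h
  rw [Fin.sum_univ_succ, Fin.sum_univ_succ]
  simp only [h0, Fin.val_zero, Fin.val_succ] at h ⊢
  simp only [tailWeight]
  push_cast at h ⊢
  simp only [zero_add, zero_mul]
  rw [← h]
  exact Finset.sum_congr rfl fun j _ => by ring

theorem apply_one_add_sum {r : ℕ} {μ : Fin (r + 2) → ℕ} (hμ : μ ∈ comps r) :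
    μ 1 + ∑ i ∈ Finset.univ \ ({0, 1} : Finset (Fin (r + 2))), μ i = r := by
  obtain ⟨h0, h1⟩ := mem_comps.mp hμ
  rw [Fin.sum_univ_succ, Fin.sum_univ_succ, h0, zero_add] at h1
  rw [sum_univ_sdiff_pair]
  exact h1

theorem exists_tail_eq {r d : ℕ} (hrd : r ≤ d) {ν : Fin d → ℕ} (hν : tailWeight ν ≤ r) :
    ∃ μ ∈ comps r, tail d μ = ν := by
  have htail : tail d (Fin.cons 0 (Fin.cons (r - ∑ j, ν j)
      fun j : Fin r => ν (Fin.castLE hrd j)) : Fin (r + 2) → ℕ) = ν := by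
    funext j
    by_cases hj : j.val < r
    · have hj' : j.val + 2 < r + 2 := by omega
      simp only [tail, zeroExtend, hj', dite_true]
      rfl
    · have hj' : ¬ j.val + 2 < r + 2 := by omega
      simp only [tail, zeroExtend, hj', dite_false]
      by_contra hne
      have h1 := mul_apply_le_tailWeight ν j
      have h2 := Nat.le_mul_of_pos_right (j.val + 1) (Nat.pos_of_ne_zero (Ne.symm hne))
      omega
  refine ⟨_, mem_comps.mpr ⟨rfl, ?_⟩, htail⟩
  have hs := sum_tail_eq hrd (Fin.cons 0 (Fin.cons (r - ∑ j, ν j)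
      fun j : Fin r => ν (Fin.castLE hrd j)) : Fin (r + 2) → ℕ)
  rw [htail, sum_univ_sdiff_pair] at hs
  rw [Fin.sum_univ_succ, Fin.sum_univ_succ, ← hs]
  have := sum_le_tailWeight ν
  simp only [Fin.cons_zero, Fin.cons_succ]
  omega

theorem injOn_tail {r d : ℕ} (hrd : r ≤ d) :
    Set.InjOn (tail d) (comps r : Set (Fin (r + 2) → ℕ)) := by
  intro μ hμ μ' hμ' h
  have h1 := apply_one_add_sum hμ
  have h1' := apply_one_add_sum hμ'
  rw [← sum_tail_eq hrd] at h1 h1'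
  rw [h] at h1
  funext i
  refine Fin.cases ?_ (fun i => Fin.cases ?_ (fun j => ?_) i) i
  · rw [(mem_comps.mp hμ).1, (mem_comps.mp hμ').1]
  · change μ 1 = μ' 1
    omega
  · have hj : j.val + 2 < r + 2 := by omega
    have := congrFun h (Fin.castLE hrd j)
    simp only [tail, zeroExtend, Fin.val_castLE, hj, dite_true] at this
    exact this

/-- A sum over compositions is a sum over tails, as long as tails of large weight do not
contribute. -/
theorem sum_comps_eq_sum_tailBox {r d K : ℕ} (hrd : r ≤ d) (hrK : r ≤ K)
    (f : (Fin (r + 2) → ℕ) → ℂ) (g : (Fin d → ℕ) → ℂ)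
    (hg : ∀ ν, r < tailWeight ν → g ν = 0) (hfg : ∀ μ ∈ comps r, f μ = g (tail d μ)) :
    ∑ μ ∈ comps r, f μ = ∑ ν ∈ tailBox d K, g ν := by
  refine Finset.sum_of_injOn (tail d) (injOn_tail hrd) ?_ ?_ hfg
  · intro μ hμ
    have h1 := apply_one_add_sum hμ
    rw [← sum_tail_eq hrd] at h1
    refine mem_tailBox.mpr fun j => ?_
    have := Finset.single_le_sum (f := tail d μ) (fun _ _ => Nat.zero_le _) (Finset.mem_univ j)
    omega
  · intro ν _ hν
    refine hg ν (not_le.mp fun hle => hν ?_)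
    obtain ⟨μ, hμ, rfl⟩ := exists_tail_eq hrd hle
    exact ⟨μ, hμ, rfl⟩

theorem neg_one_pow_apply_one {r d : ℕ} (hrd : r ≤ d) {μ : Fin (r + 2) → ℕ} (hμ : μ ∈ comps r) :
    (-1 : ℂ) ^ μ 1 = (-1) ^ (r + ∑ j, tail d μ j) := by
  have h := apply_one_add_sum hμ
  rw [← sum_tail_eq hrd] at h
  have hs : r + ∑ j, tail d μ j = μ 1 + 2 * ∑ j, tail d μ j := by omega
  rw [hs, pow_add, pow_mul]
  simp

theorem FF_eq_sum_tailBox (α : ℂ) (c : ℕ → ℂ) (x : ℂ) (r a : ℕ) (ha : 1 ≤ a) :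
    FF α c x r a = -α ^ x / ((Nat.factorial (a - 1)) : ℂ) * ∑ ν ∈ tailBox r r,
      (-1 : ℂ) ^ (r + ∑ j, ν j) *
      gbinom x ((r : ℤ) - (tailWeight ν : ℤ) - ((a : ℤ) - 1)) *
      ((Nat.factorial (r + ∑ j, ν j)) : ℂ) *
      α ^ (-((r : ℤ) - (tailWeight ν : ℤ) - ((a : ℤ) - 1))) *
      c 1 ^ (-((r : ℤ) + 1 + ((∑ j, ν j : ℕ) : ℤ))) * tailProd c ν := by
  unfold FF
  congr 1
  refine sum_comps_eq_sum_tailBox le_rfl le_rfl _ _ ?_ ?_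
  · intro ν hν
    rw [gbinom_of_neg x (by omega)]
    simp
  · intro μ hμ
    rw [neg_one_pow_apply_one le_rfl hμ, tailWeight_tail le_rfl (mem_comps.mp hμ).1,
      tailProd_tail c le_rfl, sum_tail_eq le_rfl]
    push_cast
    rfl

theorem sum_add_single {d : ℕ} (ν : Fin d → ℕ) (i : Fin d) :
    ∑ j, (ν + Pi.single i 1 : Fin d → ℕ) j = ∑ j, ν j + 1 := by
  simp [Finset.sum_add_distrib]

theorem tailWeight_add_single {d : ℕ} (ν : Fin d → ℕ) (i : Fin d) :
    tailWeight (ν + Pi.single i 1) = tailWeight ν + (i.val + 1) := by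
  simp [tailWeight, mul_add, Finset.sum_add_distrib, Pi.single_apply]

theorem apply_mul_tailProd_add_single (c : ℕ → ℂ) {d : ℕ} (ν : Fin d → ℕ) (i : Fin d) :
    (((ν + Pi.single i 1 : Fin d → ℕ) i : ℕ) : ℂ) * tailProd c (ν + Pi.single i 1) =
      c (i.val + 2) * tailProd c ν := by
  unfold tailProd
  rw [← Finset.mul_prod_erase _ _ (Finset.mem_univ i),
    ← Finset.mul_prod_erase (a := i) _ _ (Finset.mem_univ i)]
  have h : ∀ j ∈ Finset.univ.erase i, (ν + Pi.single i 1 : Fin d → ℕ) j = ν j := by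
    intro j hj
    simp [Finset.ne_of_mem_erase hj]
  rw [Finset.prod_congr rfl fun j hj => by rw [h j hj]]
  have hf : ((Nat.factorial (ν i)) : ℂ) ≠ 0 := Nat.cast_ne_zero.mpr (Nat.factorial_ne_zero _)
  have hs : ((ν i : ℂ) + 1) ≠ 0 := Nat.cast_add_one_ne_zero _
  simp only [Pi.add_apply, Pi.single_eq_same, Nat.factorial_succ]
  push_cast
  field_simp
  ring

/-- Increasing the `i`-th entry of a tail absorbs a factor `c_{i+2}`. -/
theorem sum_tailBox_shift (c : ℕ → ℂ) {d K : ℕ} (i : Fin d) (h : (Fin d → ℕ) → ℂ)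
    (hh : ∀ ν, K < tailWeight ν → h ν = 0) :
    ∑ ν ∈ tailBox d K, c (i.val + 2) * tailProd c ν * h (ν + Pi.single i 1) =
      ∑ ν ∈ tailBox d K, (ν i : ℂ) * tailProd c ν * h ν := by
  have hsub : ∑ ν ∈ (tailBox d K).filter (fun ν => ν i < K),
        c (i.val + 2) * tailProd c ν * h (ν + Pi.single i 1) =
      ∑ ν ∈ tailBox d K, c (i.val + 2) * tailProd c ν * h (ν + Pi.single i 1) := by
    refine Finset.sum_subset (Finset.filter_subset _ _) fun ν hν hν' => ?_
    have h1 : K ≤ ν i := by simpa [hν] using hν'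
    have h2 := apply_le_tailWeight ν i
    rw [hh _ (by rw [tailWeight_add_single]; omega), mul_zero]
  rw [← hsub]
  refine Finset.sum_of_injOn (fun ν => ν + Pi.single i 1) (add_left_injective _).injOn ?_ ?_ ?_
  · intro ν hν
    obtain ⟨h1, h2⟩ := Finset.mem_filter.mp hν
    refine mem_tailBox.mpr fun j => ?_
    have h3 := mem_tailBox.mp h1 j
    by_cases hj : j = i
    · subst hj
      simpa using h2
    · simpa [hj] using h3
  · intro ν hν hν'
    suffices ν i = 0 by simp [this]
    by_contra hne
    have hle : (Pi.single i 1 : Fin d → ℕ) ≤ ν := by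
      intro j
      by_cases hj : j = i
      · subst hj
        simp
        omega
      · simp [hj]
    refine hν' ⟨ν - Pi.single i 1, ?_, tsub_add_cancel_of_le hle⟩
    have hb := mem_tailBox.mp hν
    refine Finset.mem_coe.mpr (Finset.mem_filter.mpr ⟨mem_tailBox.mpr fun j => ?_, ?_⟩)
    · exact (Nat.sub_le _ _).trans (hb j)
    · have := hb i
      simp
      omega
  · intro ν _
    rw [apply_mul_tailProd_add_single]

theorem sum_add_two_mul {d : ℕ} (ν : Fin d → ℕ) :
    ∑ j, (j.val + 2) * ν j = tailWeight ν + ∑ j, ν j := by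
  rw [tailWeight, ← Finset.sum_add_distrib]
  exact Finset.sum_congr rfl fun j _ => by ring

/-- The contribution of a tail to the combined sums. -/
noncomputable def tailTerm (α : ℂ) (c : ℕ → ℂ) (x : ℂ) (n : ℕ) {d : ℕ} (ν : Fin d → ℕ) : ℂ :=
  (-1 : ℂ) ^ (n + ∑ j, ν j) * gbinom x ((n : ℤ) + 1 - (tailWeight ν : ℤ)) *
    ((Nat.factorial (n + ∑ j, ν j)) : ℂ) * α ^ (-((n : ℤ) + 1 - (tailWeight ν : ℤ))) *
    c 1 ^ (-((n : ℤ) + 1 + ((∑ j, ν j : ℕ) : ℤ)))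

theorem tailTerm_eq_zero (α : ℂ) (c : ℕ → ℂ) (x : ℂ) (n : ℕ) {d : ℕ} (ν : Fin d → ℕ)
    (hν : n + 1 < tailWeight ν) : tailTerm α c x n ν = 0 := by
  rw [tailTerm, gbinom_of_neg x (by omega)]
  simp

theorem mul_FF_one (α : ℂ) (c : ℕ → ℂ) (hc : c 1 ≠ 0) (x : ℂ) (n : ℕ) :
    c 1 * FF α c x (n + 1) 1 = α ^ x * ∑ ν ∈ tailBox (n + 1) (n + 1),
      ((n : ℂ) + 1 + ((∑ j, ν j : ℕ) : ℂ)) * tailProd c ν * tailTerm α c x n ν := by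
  rw [FF_eq_sum_tailBox _ _ _ _ _ le_rfl, Finset.mul_sum, Finset.mul_sum, Finset.mul_sum]
  refine Finset.sum_congr rfl fun ν _ => ?_
  have hz : c 1 ^ (-((n : ℤ) + 1 + ((∑ j, ν j : ℕ) : ℤ))) =
      c 1 * c 1 ^ (-(((n + 1 : ℕ) : ℤ) + 1 + ((∑ j, ν j : ℕ) : ℤ))) := by
    rw [← zpow_one_add₀ hc]
    congr 1
    push_cast
    ring
  have hm : ((n + 1 : ℕ) : ℤ) - (tailWeight ν : ℤ) - (((1 : ℕ) : ℤ) - 1) =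
      (n : ℤ) + 1 - (tailWeight ν : ℤ) := by
    push_cast
    ring
  rw [tailTerm, hz, hm, show n + 1 + ∑ j, ν j = n + ∑ j, ν j + 1 by ring, Nat.factorial_succ,
    pow_succ]
  simp only [Nat.sub_self, Nat.factorial_zero]
  push_cast
  ring

theorem mul_FF_add_two (α : ℂ) (c : ℕ → ℂ) (x : ℂ) (n : ℕ) (i : Fin (n + 1)) :
    ((Nat.factorial (i.val + 2)) : ℂ) * c (i.val + 2) * FF α c x (n + 1) (i.val + 2) =
      -α ^ x * ∑ ν ∈ tailBox (n + 1) (n + 1),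
        (((i.val + 2) * ν i : ℕ) : ℂ) * tailProd c ν * tailTerm α c x n ν := by
  have hshift := sum_tailBox_shift c i (K := n + 1) (tailTerm α c x n)
    (tailTerm_eq_zero α c x n)
  have hL : ∑ ν ∈ tailBox (n + 1) (n + 1),
        (((i.val + 2) * ν i : ℕ) : ℂ) * tailProd c ν * tailTerm α c x n ν =
      ((i.val : ℂ) + 2) * ∑ ν ∈ tailBox (n + 1) (n + 1),
        (ν i : ℂ) * tailProd c ν * tailTerm α c x n ν := by
    rw [Finset.mul_sum]
    refine Finset.sum_congr rfl fun ν _ => ?_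
    push_cast
    ring
  have hf : ((Nat.factorial (i.val + 1)) : ℂ) ≠ 0 :=
    Nat.cast_ne_zero.mpr (Nat.factorial_ne_zero _)
  have hcoef : ((Nat.factorial (i.val + 2)) : ℂ) =
      ((i.val : ℂ) + 2) * ((Nat.factorial (i.val + 1)) : ℂ) := by
    rw [Nat.factorial_succ]
    push_cast
    ring
  rw [hL, ← hshift, FF_eq_sum_tailBox _ _ _ _ _ (by omega), hcoef, Finset.mul_sum,
    Finset.mul_sum, Finset.mul_sum, Finset.mul_sum]
  refine Finset.sum_congr rfl fun ν _ => ?_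
  have hm : ((n + 1 : ℕ) : ℤ) - (tailWeight ν : ℤ) - (((i.val + 2 : ℕ) : ℤ) - 1) =
      (n : ℤ) + 1 - ((tailWeight ν + (i.val + 1) : ℕ) : ℤ) := by
    push_cast
    ring
  have hz : ((n + 1 : ℕ) : ℤ) + 1 + ((∑ j, ν j : ℕ) : ℤ) =
      (n : ℤ) + 1 + ((∑ j, ν j + 1 : ℕ) : ℤ) := by
    push_cast
    ring
  rw [tailTerm, sum_add_single, tailWeight_add_single, hm, hz,
    show n + 1 + ∑ j, ν j = n + (∑ j, ν j + 1) by ring,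
    show i.val + 2 - 1 = i.val + 1 by omega]
  field_simp

theorem F_linear_combination_identity
    (α : ℂ) (hα : α ≠ 0) (c : ℕ → ℂ) (hc : c 1 ≠ 0)
    (N : ℕ) (hN : 2 ≤ N) (x : ℂ) :
    c 1 * FF α c x (N - 1) 1 +
        ∑ i ∈ Finset.Icc 2 N, ((Nat.factorial i) : ℂ) * c i * FF α c x (N - 1) i =
      ∑ μ ∈ comps (N - 2),
        α ^ x *
          α ^ (-((N : ℤ) - 1 - ∑ i : Fin (N - 2 + 2), ((i.val : ℤ) - 1) * μ i)) *
          (((N : ℤ) - 1 - ∑ i : Fin (N - 2 + 2), ((i.val : ℤ) - 1) * μ i) : ℂ) *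
          gbinom x ((N : ℤ) - 1 - ∑ i : Fin (N - 2 + 2), ((i.val : ℤ) - 1) * μ i) *
          (-1 : ℂ) ^ μ 1 *
          ((Nat.factorial (N - 2 + ∑ i ∈ Finset.univ \ ({0, 1} : Finset (Fin (N - 2 + 2))), μ i)) : ℂ) *
          c 1 ^ (-((N : ℤ) - 1 + ∑ i ∈ Finset.univ \ ({0, 1} : Finset (Fin (N - 2 + 2))), ((μ i : ℤ)))) *
          ∏ i ∈ Finset.univ \ ({0, 1} : Finset (Fin (N - 2 + 2))), (c i ^ μ i / ((Nat.factorial (μ i)) : ℂ)) := by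
  generalize hn : N - 2 = n
  obtain rfl : N = n + 2 := by omega
  rw [show n + 2 - 1 = n + 1 by omega]
  have hIcc : ∑ i ∈ Finset.Icc 2 (n + 2),
        ((Nat.factorial i) : ℂ) * c i * FF α c x (n + 1) i =
      ∑ i : Fin (n + 1),
        ((Nat.factorial (i.val + 2)) : ℂ) * c (i.val + 2) * FF α c x (n + 1) (i.val + 2) := by
    rw [Fin.sum_univ_eq_sum_range (fun k => ((Nat.factorial (k + 2)) : ℂ) * c (k + 2) *
      FF α c x (n + 1) (k + 2)) (n + 1), Finset.range_eq_Ico, Finset.sum_Ico_add'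
      (fun k => ((Nat.factorial k) : ℂ) * c k * FF α c x (n + 1) k)]
    rfl
  rw [hIcc, mul_FF_one α c hc, Finset.sum_congr rfl fun i _ => mul_FF_add_two α c x n i,
    ← Finset.mul_sum, Finset.sum_comm, neg_mul, ← sub_eq_add_neg, ← mul_sub,
    ← Finset.sum_sub_distrib, Finset.mul_sum]
  have hcomb : ∀ ν : Fin (n + 1) → ℕ,
      α ^ x * (((n : ℂ) + 1 + ((∑ j, ν j : ℕ) : ℂ)) * tailProd c ν * tailTerm α c x n ν -
        ∑ i : Fin (n + 1), (((i.val + 2) * ν i : ℕ) : ℂ) * tailProd c ν * tailTerm α c x n ν) =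
      α ^ x * (((n : ℂ) + 1 - (tailWeight ν : ℂ)) * tailProd c ν * tailTerm α c x n ν) := by
    intro ν
    rw [← Finset.sum_mul, ← Finset.sum_mul, ← Nat.cast_sum, sum_add_two_mul, Nat.cast_add]
    ring
  symm
  refine sum_comps_eq_sum_tailBox (Nat.le_succ n) (Nat.le_succ n) _ _ ?_ ?_
  · intro ν hν
    rw [hcomb]
    rcases (Nat.succ_le_of_lt hν).eq_or_lt with h | h
    · rw [← h]
      push_cast
      ring
    · rw [tailTerm_eq_zero α c x n ν h]
      ring
  · intro μ hμ
    have hw := tailWeight_tail (Nat.le_succ n) (mem_comps.mp hμ).1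
    rw [hcomb, tailTerm, neg_one_pow_apply_one (Nat.le_succ n) hμ, ← hw,
      ← tailProd_tail c (Nat.le_succ n), ← sum_tail_eq (Nat.le_succ n), ← Nat.cast_sum,
      ← sum_tail_eq (Nat.le_succ n)]
    have hm : ((n + 2 : ℕ) : ℤ) - 1 = (n : ℤ) + 1 := by
      push_cast
      ring
    rw [hm]
    push_cast
    ring
end

section
/- For every integer N ≥ 1, all nonzero β₁, β₂ ∈ ℂ, and all complex numbers γ₁,…,γ_N: Σ_{k=1}^{N} (β₂^{−1}−1)_{k−1}·β₁^{−(k−1)}·Σ_{P ∈ S(N,k)} ∏_{B ∈ P} (β₁^{−1} − 1 + β₁^{−1}·Σ_{i∈B} γ_i)_{|B|−1} = ((β₁β₂)^{−1} − 1 + β₁^{−1}·Σ_{i=1}^N γ_i)_{N−1}. -/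
open Finset Complex

/-- Unordered partitions of the finite set `H` into `k` non-empty pairwise
disjoint blocks. -/
def setPartitions {β : Type*} [DecidableEq β] (H : Finset β) (k : ℕ) :
    Finset (Finset (Finset β)) :=
  H.powerset.powerset.filter fun P =>
    P.card = k ∧ (∀ B ∈ P, B.Nonempty) ∧
      (∀ B ∈ P, ∀ B' ∈ P, B ≠ B' → Disjoint B B') ∧ P.sup id = H

theorem fallFac_zero (z : ℂ) : fallFac z 0 = 1 := by simp [fallFac]

theorem fallFac_succ (z : ℂ) (k : ℕ) : fallFac z (k + 1) = z * fallFac (z - 1) k := by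
  simp only [fallFac, Finset.prod_range_succ']
  rw [mul_comm]
  congr 1
  · simp
  · exact Finset.prod_congr rfl fun j _ => by push_cast; ring

theorem fallFac_succ_right (z : ℂ) (k : ℕ) : fallFac z (k + 1) = fallFac z k * (z - k) := by
  simp [fallFac, Finset.prod_range_succ]

theorem fallFac_add_one_sub (z : ℂ) (k : ℕ) :
    fallFac (z + 1) k - fallFac z k = k * fallFac z (k - 1) := by
  cases k with
  | zero => simp [fallFac_zero]
  | succ k =>
    rw [fallFac_succ, fallFac_succ_right]
    simp only [add_sub_cancel_right, Nat.add_sub_cancel]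
    push_cast
    ring

theorem fallFac_eq_eval (z : ℂ) (k : ℕ) : fallFac z k = (descPochhammer ℂ k).eval z := by
  rw [descPochhammer_eval_eq_prod_range, fallFac]

/-- Two consecutive runs of factors merge into a single falling factorial. -/
theorem fallFac_neg_mul_fallFac (w : ℂ) (m l : ℕ) :
    fallFac (-w) m * fallFac (w - 1) l = (-1) ^ m * fallFac (w + m - 1) (m + l) := by
  induction m with
  | zero => simp [fallFac_zero]
  | succ m ih =>
    have h : m + 1 + l = (m + l) + 1 := by ring
    rw [fallFac_succ_right, h, fallFac_succ, mul_right_comm, ih]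
    have h2 : w + ((m + 1 : ℕ) : ℂ) - 1 - 1 = w + m - 1 := by push_cast; ring
    rw [h2]
    push_cast
    ring

section Subsets

variable {β : Type*} [DecidableEq β]

theorem sum_powerset_sum_mem_erase {M : Type*} [AddCommMonoid M] (H : Finset β)
    (f : β → Finset β → M) :
    ∑ A ∈ H.powerset, ∑ i ∈ A, f i (A.erase i) =
      ∑ i ∈ H, ∑ A ∈ (H.erase i).powerset, f i A := by
  rw [Finset.sum_sigma', Finset.sum_sigma']
  refine Finset.sum_bij' (fun p _ => ⟨p.2, p.1.erase p.2⟩) (fun q _ => ⟨insert q.1 q.2, q.1⟩)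
    ?_ ?_ ?_ ?_ ?_
  · rintro ⟨A, i⟩ h
    simp only [Finset.mem_sigma, Finset.mem_powerset] at h ⊢
    exact ⟨h.1 h.2, Finset.erase_subset_erase _ h.1⟩
  · rintro ⟨i, A⟩ h
    simp only [Finset.mem_sigma, Finset.mem_powerset] at h ⊢
    exact ⟨Finset.insert_subset h.1 (h.2.trans (Finset.erase_subset _ _)),
      Finset.mem_insert_self _ _⟩
  · rintro ⟨A, i⟩ h
    simp only [Finset.mem_sigma, Finset.mem_powerset] at h
    simp [Finset.insert_erase h.2]
  · rintro ⟨i, A⟩ h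
    simp only [Finset.mem_sigma, Finset.mem_powerset] at h
    have : i ∉ A := fun hi => by simpa using h.2 hi
    simp [Finset.erase_insert this]
  · rintro ⟨A, i⟩ _
    rfl

/-- A mixed finite difference of order `#H` kills products of fewer than `#H` affine factors. -/
theorem sum_powerset_neg_one_pow_mul_prod_eq_zero (d : β → ℂ) (m : ℕ) :
    ∀ (H : Finset β) (r : ℕ → ℂ), m < H.card →
      ∑ A ∈ H.powerset, (-1) ^ A.card * ∏ j ∈ Finset.range m, (r j + ∑ i ∈ A, d i) = 0 := by
  induction m with
  | zero =>
    intro H r h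
    have h0 := Finset.sum_powerset_neg_one_pow_card_of_nonempty (Finset.card_pos.mp h)
    have h1 : ((∑ A ∈ H.powerset, (-1) ^ A.card : ℤ) : ℂ) = 0 := by rw [h0]; simp
    simpa using h1
  | succ m ih =>
    intro H r h
    have key : ∀ A ∈ H.powerset,
        (-1 : ℂ) ^ A.card * ∏ j ∈ Finset.range (m + 1), (r j + ∑ i ∈ A, d i) =
          r m * ((-1) ^ A.card * ∏ j ∈ Finset.range m, (r j + ∑ i ∈ A, d i)) +
          ∑ i ∈ A, -d i * ((-1) ^ (A.erase i).card *
            ∏ j ∈ Finset.range m, ((r j + d i) + ∑ i ∈ A.erase i, d i)) := by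
      intro A _
      have h1 : ∀ i ∈ A, -d i * ((-1) ^ (A.erase i).card *
            ∏ j ∈ Finset.range m, ((r j + d i) + ∑ i ∈ A.erase i, d i)) =
          d i * ((-1) ^ A.card * ∏ j ∈ Finset.range m, (r j + ∑ i ∈ A, d i)) := by
        intro i hi
        rw [← Finset.card_erase_add_one hi, ← Finset.add_sum_erase A d hi]
        simp only [add_assoc, pow_succ]
        ring
      rw [Finset.sum_congr rfl h1, ← Finset.sum_mul, Finset.prod_range_succ]
      ring
    rw [Finset.sum_congr rfl key, Finset.sum_add_distrib, ← Finset.mul_sum,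
      ih H r (by omega), mul_zero, zero_add,
      sum_powerset_sum_mem_erase H fun i A => -d i * ((-1) ^ A.card *
        ∏ j ∈ Finset.range m, ((r j + d i) + ∑ i ∈ A, d i))]
    refine Finset.sum_eq_zero fun i hi => ?_
    rw [← Finset.mul_sum, ih (H.erase i) (fun j => r j + d i)
      (by rw [Finset.card_erase_of_mem hi]; omega), mul_zero]

/-- The multivariate Abel-type falling factorial attached to a finite set with weights `c`. -/
noncomputable def abelFac (c : β → ℂ) (z : ℂ) (A : Finset β) : ℂ :=
  if A = ∅ then 1 else z * fallFac (z - 1 + ∑ i ∈ A, c i) (A.card - 1)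

theorem abelFac_empty (c : β → ℂ) (z : ℂ) : abelFac c z ∅ = 1 := by simp [abelFac]

theorem abelFac_of_nonempty (c : β → ℂ) (z : ℂ) {A : Finset β} (hA : A.Nonempty) :
    abelFac c z A = z * fallFac (z - 1 + ∑ i ∈ A, c i) (A.card - 1) := by
  simp [abelFac, hA.ne_empty]

theorem abelFac_insert (c : β → ℂ) (z : ℂ) {x : β} {A : Finset β} (hx : x ∉ A) :
    abelFac c z (insert x A) = z * fallFac (z - 1 + c x + ∑ i ∈ A, c i) A.card := by
  rw [abelFac_of_nonempty c z (Finset.insert_nonempty x A), Finset.sum_insert hx,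
    Finset.card_insert_of_notMem hx, Nat.add_sub_cancel, ← add_assoc]

theorem sum_fallFac_mul_abelFac_of_add_eq_zero (c : β → ℂ) (z : ℂ) {H : Finset β}
    (hH : H.Nonempty) :
    ∑ A ∈ H.powerset,
      fallFac (-z - ∑ i ∈ H, c i + ∑ i ∈ A, c i) A.card * abelFac c z (H \ A) = 0 := by
  have hcard : 0 < H.card := Finset.card_pos.mpr hH
  have key : ∀ A ∈ H.powerset,
      fallFac (-z - ∑ i ∈ H, c i + ∑ i ∈ A, c i) A.card * abelFac c z (H \ A) =
        z * ((-1) ^ A.card * ∏ j ∈ Finset.range (H.card - 1),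
          ((z + ∑ i ∈ H, c i - 1 - j) + ∑ i ∈ A, (1 - c i))) := by
    intro A hA
    rw [Finset.mem_powerset] at hA
    have hs := Finset.sum_sdiff (f := c) hA
    have hc := Finset.card_sdiff_add_card_eq_card hA
    have hprod : ∏ j ∈ Finset.range (H.card - 1),
        ((z + ∑ i ∈ H, c i - 1 - j) + ∑ i ∈ A, (1 - c i)) =
        fallFac (z + ∑ i ∈ H \ A, c i + A.card - 1) (H.card - 1) := by
      refine Finset.prod_congr rfl fun j _ => ?_
      rw [← hs, Finset.sum_sub_distrib]
      simp
      ring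
    rw [hprod]
    rcases (H \ A).eq_empty_or_nonempty with h | h
    · have hAH : A.card = (H.card - 1) + 1 := by rw [h] at hc; simp at hc; omega
      have h2 : -z - ∑ i ∈ H, c i + ∑ i ∈ A, c i = -z := by rw [← hs, h]; simp
      rw [h, h2, abelFac_empty, mul_one, hAH, fallFac_succ]
      have h3 := fallFac_neg_mul_fallFac (z + 1) (H.card - 1) 0
      rw [fallFac_zero, mul_one, add_zero] at h3
      rw [show -z - 1 = -(z + 1) by ring, h3]
      simp only [Finset.sum_empty]
      push_cast
      rw [show z + 0 + (((H.card - 1 : ℕ) : ℂ) + 1) - 1 = z + 1 + ((H.card - 1 : ℕ) : ℂ) - 1 by ring]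
      ring
    · have h1 := Finset.card_pos.mpr h
      have h3 := fallFac_neg_mul_fallFac (z + ∑ i ∈ H \ A, c i) A.card ((H \ A).card - 1)
      rw [abelFac_of_nonempty c z h, show H.card - 1 = A.card + ((H \ A).card - 1) by omega,
        ← h3, ← hs]
      rw [show -z - (∑ i ∈ H \ A, c i + ∑ i ∈ A, c i) + ∑ i ∈ A, c i
          = -(z + ∑ i ∈ H \ A, c i) by ring,
        show z - 1 + ∑ i ∈ H \ A, c i = z + ∑ i ∈ H \ A, c i - 1 by ring]
      ring
  rw [Finset.sum_congr rfl key, ← Finset.mul_sum,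
    sum_powerset_neg_one_pow_mul_prod_eq_zero (fun i => 1 - c i) (H.card - 1) H
      (fun j => z + ∑ i ∈ H, c i - 1 - j) (by omega), mul_zero]

/-- A Hurwitz-type identity for falling factorials. -/
theorem sum_fallFac_mul_abelFac (c : β → ℂ) (z : ℂ) (H : Finset β) :
    ∀ u : ℂ, ∑ A ∈ H.powerset, fallFac (u + ∑ i ∈ A, c i) A.card * abelFac c z (H \ A) =
      fallFac (u + z + ∑ i ∈ H, c i) H.card := by
  induction H using Finset.strongInduction with
  | H H ih =>
  rcases H.eq_empty_or_nonempty with rfl | hH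
  · intro u
    simp [fallFac_zero, abelFac_empty]
  set f : ℂ → ℂ := fun u =>
    ∑ A ∈ H.powerset, fallFac (u + ∑ i ∈ A, c i) A.card * abelFac c z (H \ A) with hf
  set g : ℂ → ℂ := fun u => fallFac (u + z + ∑ i ∈ H, c i) H.card with hg
  have hdf : ∀ u, f (u + 1) - f u =
      H.card * fallFac (u + z + ∑ i ∈ H, c i) (H.card - 1) := by
    intro u
    have h1 : ∀ A ∈ H.powerset,
        fallFac (u + 1 + ∑ i ∈ A, c i) A.card * abelFac c z (H \ A) -
          fallFac (u + ∑ i ∈ A, c i) A.card * abelFac c z (H \ A) =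
        ∑ x ∈ A, fallFac (u + c x + ∑ i ∈ A.erase x, c i) (A.erase x).card *
          abelFac c z (H.erase x \ A.erase x) := by
      intro A hA
      have h2 : ∀ x ∈ A, fallFac (u + c x + ∑ i ∈ A.erase x, c i) (A.erase x).card *
          abelFac c z (H.erase x \ A.erase x) =
          fallFac (u + ∑ i ∈ A, c i) (A.card - 1) * abelFac c z (H \ A) := by
        intro x hx
        rw [Finset.card_erase_of_mem hx, add_assoc, Finset.add_sum_erase A c hx]
        congr 2
        ext y
        by_cases hy : y = x
        · subst hy; simp [hx]
        · simp [hy]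
      rw [Finset.sum_congr rfl h2, Finset.sum_const, nsmul_eq_mul, ← sub_mul, ← mul_assoc,
        ← fallFac_add_one_sub, add_right_comm]
    simp only [hf]
    rw [← Finset.sum_sub_distrib, Finset.sum_congr rfl h1,
      sum_powerset_sum_mem_erase H fun x A =>
        fallFac (u + c x + ∑ i ∈ A, c i) A.card * abelFac c z (H.erase x \ A)]
    have h3 : ∀ x ∈ H, ∑ A ∈ (H.erase x).powerset,
        fallFac (u + c x + ∑ i ∈ A, c i) A.card * abelFac c z (H.erase x \ A) =
        fallFac (u + z + ∑ i ∈ H, c i) (H.card - 1) := by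
      intro x hx
      rw [ih _ (Finset.erase_ssubset hx), Finset.card_erase_of_mem hx,
        ← Finset.add_sum_erase H c hx]
      congr 1
      ring
    rw [Finset.sum_congr rfl h3, Finset.sum_const, nsmul_eq_mul]
  have hdg : ∀ u, g (u + 1) - g u =
      H.card * fallFac (u + z + ∑ i ∈ H, c i) (H.card - 1) := by
    intro u
    rw [← fallFac_add_one_sub]
    simp only [hg]
    congr 2
    ring
  set u₀ : ℂ := -z - ∑ i ∈ H, c i with hu₀
  have heq : ∀ n : ℕ, f (u₀ + n) = g (u₀ + n) := by
    intro n
    induction n with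
    | zero =>
      have hf0 : f u₀ = 0 := sum_fallFac_mul_abelFac_of_add_eq_zero c z hH
      have hg0 : g u₀ = 0 := by
        obtain ⟨k, hk⟩ := Nat.exists_eq_succ_of_ne_zero (Finset.card_pos.mpr hH).ne'
        simp only [hg, hk, fallFac_succ]
        rw [hu₀]
        ring
      simp [hf0, hg0]
    | succ n ihn =>
      have h1 := hdf (u₀ + n)
      have h2 := hdg (u₀ + n)
      push_cast
      rw [← add_assoc]
      linear_combination h1 - h2 + ihn
  set p : Polynomial ℂ := ∑ A ∈ H.powerset,
    (descPochhammer ℂ A.card).comp (Polynomial.X + Polynomial.C (∑ i ∈ A, c i)) *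
      Polynomial.C (abelFac c z (H \ A)) with hp
  set q : Polynomial ℂ := (descPochhammer ℂ H.card).comp
    (Polynomial.X + Polynomial.C (z + ∑ i ∈ H, c i)) with hq
  have hpe : ∀ u, p.eval u = f u := fun u => by
    simp only [hp, hf, Polynomial.eval_finsetSum, Polynomial.eval_mul, Polynomial.eval_comp,
      Polynomial.eval_add, Polynomial.eval_X, Polynomial.eval_C, fallFac_eq_eval]
  have hqe : ∀ u, q.eval u = g u := fun u => by
    simp only [hq, hg, Polynomial.eval_comp, Polynomial.eval_add, Polynomial.eval_X,
      Polynomial.eval_C, fallFac_eq_eval, add_assoc]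
  have hpq : p = q := by
    refine Polynomial.eq_of_infinite_eval_eq p q ?_
    refine (Set.infinite_range_of_injective (f := fun n : ℕ => u₀ + (n : ℂ))
      fun m n h => by simpa using h).mono ?_
    rintro _ ⟨n, rfl⟩
    simp only [Set.mem_ofPred_eq, hpe, hqe, heq]
  intro u
  change f u = g u
  rw [← hpe, ← hqe, hpq]

theorem mem_setPartitions {H : Finset β} {k : ℕ} {P : Finset (Finset β)} :
    P ∈ setPartitions H k ↔ P.card = k ∧ (∀ B ∈ P, B.Nonempty) ∧
      (∀ B ∈ P, ∀ B' ∈ P, B ≠ B' → Disjoint B B') ∧ P.sup id = H := by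
  simp only [setPartitions, Finset.mem_filter, Finset.mem_powerset, and_iff_right_iff_imp]
  rintro ⟨-, -, -, rfl⟩ B hB
  exact Finset.mem_powerset.mpr (Finset.le_sup (f := id) hB)

theorem subset_of_mem_setPartitions {H : Finset β} {k : ℕ} {P : Finset (Finset β)}
    (hP : P ∈ setPartitions H k) {B : Finset β} (hB : B ∈ P) : B ⊆ H := by
  rw [← (mem_setPartitions.mp hP).2.2.2]
  exact Finset.le_sup (f := id) hB

theorem insert_mem_setPartitions {H B : Finset β} {k : ℕ} {Q : Finset (Finset β)}
    (hB : B.Nonempty) (hBH : B ⊆ H) (hQ : Q ∈ setPartitions (H \ B) k) :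
    B ∉ Q ∧ insert B Q ∈ setPartitions H (k + 1) := by
  have hd : ∀ C ∈ Q, Disjoint B C := fun C hC =>
    Finset.disjoint_sdiff.mono_right (subset_of_mem_setPartitions hQ hC)
  have hBQ : B ∉ Q := fun h => hB.ne_empty (disjoint_self.mp (hd B h))
  obtain ⟨h1, h2, h3, h4⟩ := mem_setPartitions.mp hQ
  refine ⟨hBQ, mem_setPartitions.mpr ⟨?_, ?_, ?_, ?_⟩⟩
  · rw [Finset.card_insert_of_notMem hBQ, h1]
  · exact Finset.forall_mem_insert _ _ _ |>.mpr ⟨hB, h2⟩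
  · intro C hC D hD hne
    rw [Finset.mem_insert] at hC hD
    rcases hC with rfl | hC <;> rcases hD with rfl | hD
    · exact absurd rfl hne
    · exact hd D hD
    · exact (hd C hC).symm
    · exact h3 C hC D hD hne
  · rw [Finset.sup_insert, h4]
    exact Finset.union_sdiff_of_subset hBH

theorem erase_mem_setPartitions {H B : Finset β} {k : ℕ} {P : Finset (Finset β)}
    (hP : P ∈ setPartitions H (k + 1)) (hB : B ∈ P) :
    P.erase B ∈ setPartitions (H \ B) k := by
  obtain ⟨h1, h2, h3, h4⟩ := mem_setPartitions.mp hP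
  refine mem_setPartitions.mpr ⟨?_, ?_, ?_, ?_⟩
  · rw [Finset.card_erase_of_mem hB, h1, Nat.add_sub_cancel]
  · exact fun C hC => h2 C (Finset.mem_of_mem_erase hC)
  · exact fun C hC D hD => h3 C (Finset.mem_of_mem_erase hC) D (Finset.mem_of_mem_erase hD)
  · have hsup : H = B ∪ (P.erase B).sup id := by
      rw [← h4]
      conv_lhs => rw [← Finset.insert_erase hB, Finset.sup_insert]
      rfl
    have hd : Disjoint ((P.erase B).sup id) B := by
      rw [Finset.disjoint_sup_left]
      exact fun C hC => h3 C (Finset.mem_of_mem_erase hC) B hB (Finset.ne_of_mem_erase hC)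
    rw [hsup, Finset.union_sdiff_left, hd.sdiff_eq_left]

/-- Summing over partitions of `insert x H` by first choosing the block of `x`. -/
theorem sum_setPartitions_insert {x : β} {H : Finset β} (hx : x ∉ H) (k : ℕ)
    (w : Finset β → ℂ) :
    ∑ P ∈ setPartitions (insert x H) (k + 1), ∏ B ∈ P, w B =
      ∑ A ∈ H.powerset, w (insert x A) * ∑ Q ∈ setPartitions (H \ A) k, ∏ B ∈ Q, w B := by
  have hsd : ∀ A : Finset β, insert x H \ insert x A = H \ A := fun A => by
    ext y
    by_cases hy : y = x
    · subst hy; simp [hx]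
    · simp [hy]
  have hins : ∀ A ∈ H.powerset, ∀ Q ∈ setPartitions (H \ A) k,
      insert x A ∉ Q ∧ insert (insert x A) Q ∈ setPartitions (insert x H) (k + 1) := by
    intro A hA Q hQ
    rw [← hsd] at hQ
    exact insert_mem_setPartitions (Finset.insert_nonempty _ _)
      (Finset.insert_subset_insert x (Finset.mem_powerset.mp hA)) hQ
  simp_rw [Finset.mul_sum]
  rw [Finset.sum_sigma']
  symm
  refine Finset.sum_bij (fun p _ => insert (insert x p.1) p.2) ?_ ?_ ?_ ?_
  · rintro ⟨A, Q⟩ h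
    rw [Finset.mem_sigma] at h
    exact (hins A h.1 Q h.2).2
  · rintro ⟨A, Q⟩ h ⟨A', Q'⟩ h' heq
    rw [Finset.mem_sigma] at h h'
    dsimp only at h h' heq
    have hxA : x ∉ A := fun hh => hx (Finset.mem_powerset.mp h.1 hh)
    have hxA' : x ∉ A' := fun hh => hx (Finset.mem_powerset.mp h'.1 hh)
    have hmem : insert x A ∈ insert (insert x A') Q' := heq ▸ Finset.mem_insert_self _ _
    have hAA : A = A' := by
      rcases Finset.mem_insert.mp hmem with h1 | h1
      · rw [← Finset.erase_insert hxA, h1, Finset.erase_insert hxA']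
      · exact absurd (Finset.mem_sdiff.mp (subset_of_mem_setPartitions h'.2 h1
          (Finset.mem_insert_self x A))).1 hx
    subst hAA
    have hQQ : Q = Q' := by
      rw [← Finset.erase_insert (hins A h.1 Q h.2).1, heq,
        Finset.erase_insert (hins A h'.1 Q' h'.2).1]
    rw [hQQ]
  · intro P hP
    have hxP : x ∈ P.sup id := by
      rw [(mem_setPartitions.mp hP).2.2.2]
      exact Finset.mem_insert_self x H
    obtain ⟨B, hB, hxB⟩ := Finset.mem_sup.mp hxP
    have hBx : insert x (B.erase x) = B := Finset.insert_erase hxB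
    refine ⟨⟨B.erase x, P.erase B⟩, ?_, ?_⟩
    · rw [Finset.mem_sigma]
      refine ⟨Finset.mem_powerset.mpr ?_, ?_⟩
      · rw [← Finset.erase_insert hx]
        exact Finset.erase_subset_erase x (subset_of_mem_setPartitions hP hB)
      · dsimp only
        rw [← hsd, hBx]
        exact erase_mem_setPartitions hP hB
    · dsimp only
      rw [hBx, Finset.insert_erase hB]
  · rintro ⟨A, Q⟩ h
    rw [Finset.mem_sigma] at h
    rw [Finset.prod_insert (hins A h.1 Q h.2).1]

theorem setPartitions_zero_of_nonempty {H : Finset β} (hH : H.Nonempty) :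
    setPartitions H 0 = ∅ := by
  refine Finset.eq_empty_of_forall_notMem fun P hP => hH.ne_empty ?_
  obtain ⟨h1, -, -, h4⟩ := mem_setPartitions.mp hP
  rw [← h4, Finset.card_eq_zero.mp h1, Finset.sup_empty, Finset.bot_eq_empty]

theorem sum_setPartitions_empty (k : ℕ) (w : Finset β → ℂ) :
    ∑ P ∈ setPartitions (∅ : Finset β) k, ∏ B ∈ P, w B = if k = 0 then 1 else 0 := by
  have hP0 : ∀ P ∈ setPartitions (∅ : Finset β) k, P = ∅ := fun P hP =>
    Finset.eq_empty_of_forall_notMem fun B hB =>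
      ((mem_setPartitions.mp hP).2.1 B hB).ne_empty
        (Finset.subset_empty.mp (subset_of_mem_setPartitions hP hB))
  split_ifs with hk
  · subst hk
    have : setPartitions (∅ : Finset β) 0 = {∅} := by
      refine Finset.eq_singleton_iff_unique_mem.mpr ⟨mem_setPartitions.mpr ?_, hP0⟩
      simp
    simp [this]
  · refine Finset.sum_eq_zero fun P hP => absurd ?_ hk
    rw [← (mem_setPartitions.mp hP).1, hP0 P hP, Finset.card_empty]

/-- Composition law for Abel-type falling factorials. -/
theorem sum_fallFac_mul_sum_setPartitions (c : β → ℂ) (a : ℂ) (H : Finset β) :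
    ∀ (b : ℂ) (M : ℕ), H.card < M →
      ∑ k ∈ Finset.range M, fallFac b k *
        ∑ P ∈ setPartitions H k, ∏ B ∈ P, abelFac c a B = abelFac c (a * b) H := by
  induction H using Finset.strongInduction with
  | H H ih =>
  intro b M hM
  rcases H.eq_empty_or_nonempty with rfl | ⟨x, hxH⟩
  · simp only [sum_setPartitions_empty, abelFac_empty, mul_ite, mul_one, mul_zero,
      Finset.sum_ite_eq', Finset.mem_range]
    rw [if_pos (by simpa using hM), fallFac_zero]
  obtain ⟨H', hx, rfl⟩ : ∃ H', x ∉ H' ∧ insert x H' = H :=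
    ⟨H.erase x, Finset.notMem_erase x H, Finset.insert_erase hxH⟩
  obtain ⟨M, rfl⟩ := Nat.exists_eq_succ_of_ne_zero (by omega : M ≠ 0)
  rw [Finset.card_insert_of_notMem hx] at hM
  rw [Finset.sum_range_succ', setPartitions_zero_of_nonempty ⟨x, hxH⟩]
  simp only [Finset.sum_empty, mul_zero, add_zero, sum_setPartitions_insert hx, fallFac_succ b]
  have hswap : ∑ k ∈ Finset.range M, b * fallFac (b - 1) k * ∑ A ∈ H'.powerset,
        abelFac c a (insert x A) *
          ∑ Q ∈ setPartitions (H' \ A) k, ∏ B ∈ Q, abelFac c a B =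
      ∑ A ∈ H'.powerset, b * abelFac c a (insert x A) * ∑ k ∈ Finset.range M,
        fallFac (b - 1) k * ∑ Q ∈ setPartitions (H' \ A) k, ∏ B ∈ Q, abelFac c a B := by
    simp_rw [Finset.mul_sum _ _ (_ * _)]
    rw [Finset.sum_comm]
    refine Finset.sum_congr rfl fun A _ => Finset.sum_congr rfl fun k _ => ?_
    ring
  rw [hswap]
  have hterm : ∀ A ∈ H'.powerset, b * abelFac c a (insert x A) * ∑ k ∈ Finset.range M,
        fallFac (b - 1) k * ∑ Q ∈ setPartitions (H' \ A) k, ∏ B ∈ Q, abelFac c a B =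
      a * b * (fallFac (a - 1 + c x + ∑ i ∈ A, c i) A.card *
        abelFac c (a * (b - 1)) (H' \ A)) := by
    intro A hA
    have hxA : x ∉ A := fun hh => hx (Finset.mem_powerset.mp hA hh)
    rw [ih (H' \ A) (Finset.sdiff_subset.trans_ssubset (Finset.ssubset_insert hx)) (b - 1) M
      ((Finset.card_le_card Finset.sdiff_subset).trans_lt (by omega)), abelFac_insert c a hxA]
    ring
  rw [Finset.sum_congr rfl hterm, ← Finset.mul_sum, sum_fallFac_mul_abelFac,
    abelFac_insert c _ hx]
  congr 2
  ring

end Subsets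

theorem falling_factorial_transformation_identity
    (N : ℕ) (hN : 1 ≤ N) (β₁ β₂ : ℂ) (hβ₁ : β₁ ≠ 0) (hβ₂ : β₂ ≠ 0)
    (γ : ℕ → ℂ) :
    ∑ k ∈ Finset.Icc 1 N,
        fallFac (β₂⁻¹ - 1) (k - 1) * β₁⁻¹ ^ (k - 1) *
          ∑ P ∈ setPartitions (Finset.Icc 1 N) k,
            ∏ B ∈ P, fallFac (β₁⁻¹ - 1 + β₁⁻¹ * ∑ i ∈ B, γ i) (B.card - 1) =
      fallFac ((β₁ * β₂)⁻¹ - 1 + β₁⁻¹ * ∑ i ∈ Finset.Icc 1 N, γ i) (N - 1) := by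
  have hne : β₁⁻¹ * β₂⁻¹ ≠ 0 := mul_ne_zero (inv_ne_zero hβ₁) (inv_ne_zero hβ₂)
  refine mul_left_cancel₀ hne ?_
  have hI : (Finset.Icc 1 N).Nonempty := ⟨1, Finset.mem_Icc.mpr ⟨le_rfl, hN⟩⟩
  have h := sum_fallFac_mul_sum_setPartitions (fun i => β₁⁻¹ * γ i) β₁⁻¹ (Finset.Icc 1 N)
    β₂⁻¹ (N + 1) (by simp)
  rw [abelFac_of_nonempty _ _ hI, ← Finset.mul_sum, Nat.card_Icc, Nat.add_sub_cancel,
    Finset.sum_range_succ', setPartitions_zero_of_nonempty hI, Finset.sum_empty, mul_zero,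
    add_zero] at h
  rw [mul_inv, ← h, Finset.mul_sum,
    show Finset.Icc 1 N = (Finset.range N).image (· + 1) by
      ext i
      simp only [Finset.mem_Icc, Finset.mem_image, Finset.mem_range]
      exact ⟨fun hi => ⟨i - 1, by omega, by omega⟩, by rintro ⟨j, hj, rfl⟩; omega⟩]
  rw [Finset.sum_image (by simp)]
  refine Finset.sum_congr rfl fun k _ => ?_
  simp only [Nat.add_sub_cancel, fallFac_succ β₂⁻¹, Finset.mul_sum]
  refine Finset.sum_congr rfl fun P hP => ?_
  obtain ⟨hcard, hnon, -, -⟩ := mem_setPartitions.mp hP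
  rw [Finset.prod_congr rfl fun B hB => abelFac_of_nonempty _ _ (hnon B hB),
    Finset.prod_mul_distrib, Finset.prod_const, hcard]
  simp only [← Finset.mul_sum]
  ring
end
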